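/- Let 2 ≤ k ≤ d and let 𝒞 be the tropical complex of the tropical hypersimplex Δ_k^d with respect to its C(d+1,k) generators −e_I. The coarse types of the inclusion-maximal cells of 𝒞 are exactly the tuples obtained by permuting the coordinates (by elements of Sym(d+1)) of the tuples ( C(d+1−α, k) + C(d, k−1), C(d−1, k−1), C(d−2, k−1), …, C(d−α+1, k−1), 0, …, 0 ), having α nonzero entries followed by d+1−α zeros, for α = 1, …, d+2−k; here C(a,b) denotes the binomial coefficient. -/

import Mathlib

open Finset

noncomputable section

variable {d n : ℕ}

/-- `x ∈ tconv {v i}`, at the level of representatives in `ℝ^{d+1}` modulo constants. -/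
def InTconv {ι : Type*} (v : ι → Fin (d + 1) → ℝ) (x : Fin (d + 1) → ℝ) : Prop :=
  ∃ (lam : ι → ℝ) (c : ℝ), ∀ j, x j + c = ⨅ i, (lam i + v i j)

/-- the `k`-th entry of the type of `x` with respect to the generators `v` -/
def typeEntry {ι : Type*} (v : ι → Fin (d + 1) → ℝ) (x : Fin (d + 1) → ℝ)
    (k : Fin (d + 1)) : Set ι :=
  {i | v i k - x k = ⨅ j, (v i j - x j)}

/-- the spanning subgraph of `G` whose edges are those indexed by `B` -/
def edgeGraph {W : Type*} (G : SimpleGraph W) (ε : Fin (d + 1) ≃ G.edgeSet)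
    (B : Finset (Fin (d + 1))) : SimpleGraph W :=
  SimpleGraph.fromEdgeSet {s | ∃ i ∈ B, (ε i : Sym2 W) = s}

/-- `B ⊆ [d+1]` is the edge set of a spanning tree of `G` -/
def IsSpanningTreeEdges {W : Type*} (G : SimpleGraph W) (ε : Fin (d + 1) ≃ G.edgeSet)
    (B : Finset (Fin (d + 1))) : Prop :=
  (edgeGraph G ε B).IsTree

/-- generators of the tropical matroid polytope, in canonical coordinates -/
def gen (Bs : Fin n → Finset (Fin (d + 1))) (l : Fin n) (i : Fin (d + 1)) : ℝ :=
  if i ∈ Bs l then 0 else 1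

/-- data of the cycle matroid of a connected bridgeless simple graph `G` whose `d+1` edges are
enumerated by `ε` and whose bases (spanning-tree edge sets, each of rank/cardinality `k`) are
enumerated without repetition by `Bs`. -/
structure MatroidData (d n k : ℕ) (W : Type) (G : SimpleGraph W)
    (ε : Fin (d + 1) ≃ G.edgeSet) (Bs : Fin n → Finset (Fin (d + 1))) : Prop where
  connected : G.Connected
  bridgeless : ∀ i : Fin (d + 1), ¬ G.IsBridge (ε i : Sym2 W)
  tree : ∀ l, IsSpanningTreeEdges G ε (Bs l)
  inj : Function.Injective Bs
  all : ∀ B : Finset (Fin (d + 1)), IsSpanningTreeEdges G ε B → ∃ l, Bs l = B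
  card : ∀ l, (Bs l).card = k

/-- minimum of `f` over a subset of coordinates (as an infimum) -/
def tmin (I : Set (Fin (d + 1))) (f : Fin (d + 1) → ℝ) : ℝ := sInf (f '' I)

/-- the closed tropical halfspace with apex `p` and type `I` -/
def Halfspace (p : Fin (d + 1) → ℝ) (I : Set (Fin (d + 1))) : Set (Fin (d + 1) → ℝ) :=
  {x | tmin I (fun i => x i - p i) ≤ tmin Iᶜ (fun j => x j - p j)}

/-- the closed cell of the tropical complex containing `p` -/
def closedCell {ι : Type*} (v : ι → Fin (d + 1) → ℝ) (p : Fin (d + 1) → ℝ) :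
    Set (Fin (d + 1) → ℝ) :=
  {x | ∀ k, typeEntry v p k ⊆ typeEntry v x k}

/-- the (closed) cells of the tropical complex `𝒞_V` -/
def IsCell {ι : Type*} (v : ι → Fin (d + 1) → ℝ) (X : Set (Fin (d + 1) → ℝ)) : Prop :=
  ∃ p, X = closedCell v p

/-- the chart `c₀ : 𝕋^d → ℝ^d` -/
def chart (x : Fin (d + 1) → ℝ) (i : Fin d) : ℝ := x i.succ - x 0

/-- a bounded cell of the tropical complex (bounded as a subset of `𝕋^d ≅ ℝ^d`) -/
def IsBoundedCell {ι : Type*} (v : ι → Fin (d + 1) → ℝ) (X : Set (Fin (d + 1) → ℝ)) : Prop :=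
  IsCell v X ∧ Bornology.IsBounded (chart '' X)

/-- an inclusion-maximal bounded cell -/
def IsMaxBoundedCell {ι : Type*} (v : ι → Fin (d + 1) → ℝ) (X : Set (Fin (d + 1) → ℝ)) : Prop :=
  IsBoundedCell v X ∧ ∀ Y, IsBoundedCell v Y → X ⊆ Y → Y = X

/-- an inclusion-maximal cell -/
def IsMaxCell {ι : Type*} (v : ι → Fin (d + 1) → ℝ) (X : Set (Fin (d + 1) → ℝ)) : Prop :=
  IsCell v X ∧ ∀ Y, IsCell v Y → X ⊆ Y → Y = X

/-- a point of the relative interior of a cell `X`: a point of `X` whose type is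
componentwise contained in the type of every point of `X` -/
def IsInteriorPoint {ι : Type*} (v : ι → Fin (d + 1) → ℝ) (X : Set (Fin (d + 1) → ℝ))
    (x : Fin (d + 1) → ℝ) : Prop :=
  x ∈ X ∧ ∀ y ∈ X, ∀ k, typeEntry v x k ⊆ typeEntry v y k

/-- `b_{I,J}`: the number of bases `B` with `I ⊆ B` and `J ∩ B = ∅` -/
def bIJ (Bs : Fin n → Finset (Fin (d + 1))) (I J : Finset (Fin (d + 1))) : ℕ :=
  (Finset.univ.filter fun l => I ⊆ Bs l ∧ Disjoint J (Bs l)).card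

/-- a pseudovertex of the tropical complex: the unique point of `𝕋^d` of its type -/
def IsPseudovertex {ι : Type*} (v : ι → Fin (d + 1) → ℝ) (x : Fin (d + 1) → ℝ) : Prop :=
  ∀ y, (∀ k, typeEntry v y k = typeEntry v x k) → ∃ c : ℝ, y = fun j => x j + c

/-- the pseudovertex `e_{i₁,…,i_s} = -e_J`, `J = [d+1] ∖ {σ 0,…,σ (s-1)}`, in canonical
coordinates: coordinate `1` at `σ 0, …, σ (s-1)` and `0` elsewhere -/
def ptSeq {r : ℕ} (σ : Fin r → Fin (d + 1)) (s : ℕ) (j : Fin (d + 1)) : ℝ :=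
  if ∃ t : Fin r, (t : ℕ) < s ∧ σ t = j then 1 else 0

/-- the generators `-e_I`, `|I| = k`, of the tropical hypersimplex `Δ_k^d`, in
canonical coordinates -/
def genU (d k : ℕ) : {I : Finset (Fin (d + 1)) // I.card = k} → Fin (d + 1) → ℝ :=
  fun I j => if j ∈ I.1 then 0 else 1

theorem mem_typeEntry_iff {ι : Type*} (v : ι → Fin (d + 1) → ℝ) (x : Fin (d + 1) → ℝ)
    (k : Fin (d + 1)) (i : ι) :
    i ∈ typeEntry v x k ↔ ∀ j, v i k - x k ≤ v i j - x j := by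
  constructor
  · intro h j
    exact (show v i k - x k = _ from h).trans_le (ciInf_le (Set.finite_range _).bddBelow j)
  · intro h
    exact le_antisymm (le_ciInf h) (ciInf_le (Set.finite_range _).bddBelow k)

theorem exists_mem_typeEntry {ι : Type*} (v : ι → Fin (d + 1) → ℝ) (x : Fin (d + 1) → ℝ)
    (i : ι) : ∃ k, i ∈ typeEntry v x k := by
  obtain ⟨k, hk⟩ := Finite.exists_min fun j => v i j - x j
  exact ⟨k, (mem_typeEntry_iff v x k i).2 hk⟩

/-- A cell all of whose generators occur in a single type entry is inclusion-maximal. -/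
theorem isMaxCell_closedCell {ι : Type*} {v : ι → Fin (d + 1) → ℝ} {x : Fin (d + 1) → ℝ}
    (hx : ∀ i j j', i ∈ typeEntry v x j → i ∈ typeEntry v x j' → j = j') :
    IsMaxCell v (closedCell v x) := by
  refine ⟨⟨x, rfl⟩, ?_⟩
  rintro _ ⟨q, rfl⟩ hY
  have hq : ∀ j, typeEntry v q j ⊆ typeEntry v x j := hY (fun _ => Set.Subset.rfl)
  have hq' : ∀ j, typeEntry v x j ⊆ typeEntry v q j := by
    intro j i hi
    obtain ⟨j', hj'⟩ := exists_mem_typeEntry v q i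
    rwa [hx i j j' hi (hq j' hj')]
  exact Set.Subset.antisymm (fun y hy j => (hq' j).trans (hy j)) hY

/-- An interior point of a maximal cell has the same type as any point of smaller type. -/
theorem typeEntry_eq_of_isMaxCell {ι : Type*} {v : ι → Fin (d + 1) → ℝ}
    {X : Set (Fin (d + 1) → ℝ)} {x y : Fin (d + 1) → ℝ} (hX : IsMaxCell v X)
    (hx : IsInteriorPoint v X x) (hy : ∀ j, typeEntry v y j ⊆ typeEntry v x j)
    (j : Fin (d + 1)) : typeEntry v x j = typeEntry v y j := by
  have hXy : closedCell v y = X :=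
    hX.2 _ ⟨y, rfl⟩ fun z hz i => (hy i).trans (hx.2 z hz i)
  exact Set.Subset.antisymm (hx.2 y (hXy ▸ fun _ => Set.Subset.rfl) j) (hy j)

/-- `j` is the position, in the order given by `σ`, of the type entry containing `I` at a point
whose largest coordinate is at `σ 0` and whose coordinates within distance `1` of the largest one
are those at `σ i`, `i < α`, in decreasing order. -/
def IsWinner (α : ℕ) (σ : Equiv.Perm (Fin (d + 1))) (I : Finset (Fin (d + 1)))
    (j : Fin (d + 1)) : Prop :=
  (j = 0 ∧ (σ 0 ∈ I ∨ ∀ i : Fin (d + 1), (i : ℕ) < α → σ i ∉ I)) ∨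
    (j ≠ 0 ∧ (j : ℕ) < α ∧ σ j ∈ I ∧ ∀ i < j, σ i ∉ I)

theorem exists_isWinner (α : ℕ) (σ : Equiv.Perm (Fin (d + 1))) (I : Finset (Fin (d + 1))) :
    ∃ j, IsWinner α σ I j := by
  by_cases h : ∃ i : Fin (d + 1), (i : ℕ) < α ∧ σ i ∈ I
  · obtain ⟨j, ⟨hjα, hj⟩, hmin⟩ :=
      WellFounded.has_min (wellFounded_lt (α := Fin (d + 1)))
        {i | (i : ℕ) < α ∧ σ i ∈ I} h
    refine ⟨j, ?_⟩
    by_cases hj0 : j = 0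
    · subst hj0
      exact Or.inl ⟨rfl, Or.inl hj⟩
    · exact Or.inr ⟨hj0, hjα, hj, fun i hi hI => hmin i ⟨lt_trans hi hjα, hI⟩ hi⟩
  · push Not at h
    exact ⟨0, Or.inl ⟨rfl, Or.inr h⟩⟩

/-- A point whose coordinates along `σ` are decreasing, spread over less than `1` for the first
`α` positions and equal to `-2` afterwards. -/
def staircase (α : ℕ) (σ : Equiv.Perm (Fin (d + 1))) (j : Fin (d + 1)) : ℝ :=
  if (σ.symm j : ℕ) < α then -((σ.symm j : ℕ) : ℝ) / (d + 1) else -2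

theorem lt_staircase {α k : ℕ} (hα : 1 ≤ α) {σ : Equiv.Perm (Fin (d + 1))}
    {I : {I : Finset (Fin (d + 1)) // I.card = k}} {j i : Fin (d + 1)}
    (hj : IsWinner α σ I.1 j) (hij : i ≠ j) :
    genU d k I (σ j) - staircase α σ (σ j) < genU d k I (σ i) - staircase α σ (σ i) := by
  have hd : (0 : ℝ) < d + 1 := by positivity
  have hlt : ∀ {a b : Fin (d + 1)}, a < b → ((a : ℕ) : ℝ) / (d + 1) < (b : ℕ) / (d + 1) :=
    fun h => by gcongr; exact_mod_cast h
  have h1 : ∀ a : Fin (d + 1), ((a : ℕ) : ℝ) / (d + 1) < 1 := fun a => by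
    rw [div_lt_one hd]; exact_mod_cast a.2
  have h0 : ∀ a : Fin (d + 1), 0 ≤ ((a : ℕ) : ℝ) / (d + 1) := fun a => by positivity
  simp only [genU, staircase, Equiv.symm_apply_apply, neg_div]
  have hi1 := h1 i
  have hi0 := h0 i
  have hj1 := h1 j
  rcases hj with ⟨rfl, h | h⟩ | ⟨hj0, hjα, hjI, hmin⟩
  · have hi := hlt (Fin.pos_iff_ne_zero.2 hij)
    simp only [Fin.val_zero, Nat.cast_zero, zero_div] at *
    split_ifs <;> first | omega | linarith
  · have hi := hlt (Fin.pos_iff_ne_zero.2 hij)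
    have hiα := h i
    have h0I := h 0 (Nat.lt_of_succ_le hα)
    simp only [Fin.val_zero, Nat.cast_zero, zero_div] at *
    split_ifs <;> first | omega | tauto | linarith
  · rcases lt_or_gt_of_ne hij with hi | hi
    · have hiI := hmin i hi
      have hiα : (i : ℕ) < α := lt_trans hi hjα
      simp only [hjI, hiI, hjα, hiα, if_true, if_false]
      linarith
    · have hi' := hlt hi
      simp only [hjI, hjα, if_true]
      split_ifs <;> linarith

theorem mem_typeEntry_staircase {α k : ℕ} (hα : 1 ≤ α) {σ : Equiv.Perm (Fin (d + 1))}
    {I : {I : Finset (Fin (d + 1)) // I.card = k}} {j : Fin (d + 1)} :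
    I ∈ typeEntry (genU d k) (staircase α σ) (σ j) ↔ IsWinner α σ I.1 j := by
  rw [mem_typeEntry_iff]
  constructor
  · intro h
    obtain ⟨j', hj'⟩ := exists_isWinner α σ I.1
    by_contra hj
    have hne : j ≠ j' := fun e => hj (e ▸ hj')
    exact (lt_staircase hα hj' hne).not_ge (h (σ j'))
  · intro h i
    by_cases hi : σ.symm i = j
    · simp [← hi]
    · simpa using (lt_staircase hα h hi).le

theorem typeEntry_staircase_unique {α k : ℕ} (hα : 1 ≤ α) {σ : Equiv.Perm (Fin (d + 1))}
    {I : {I : Finset (Fin (d + 1)) // I.card = k}} {j j' : Fin (d + 1)}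
    (hj : I ∈ typeEntry (genU d k) (staircase α σ) j)
    (hj' : I ∈ typeEntry (genU d k) (staircase α σ) j') : j = j' := by
  obtain ⟨a, rfl⟩ := σ.surjective j
  obtain ⟨b, rfl⟩ := σ.surjective j'
  by_contra hne
  have hba : b ≠ a := fun e => hne (e ▸ rfl)
  exact (lt_staircase hα ((mem_typeEntry_staircase hα).1 hj) hba).not_ge
    ((mem_typeEntry_iff _ _ _ _).1 hj' (σ a))

theorem card_filter_powersetCard_disjoint {β : Type*} [Fintype β] [DecidableEq β] (k : ℕ)
    (J : Finset β) :
    ((powersetCard k univ).filter fun I => Disjoint J I).card =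
      (Fintype.card β - J.card).choose k := by
  rw [← card_compl, ← card_powersetCard]
  congr 1
  ext I
  simp [mem_powersetCard, and_comm, subset_compl_iff_disjoint_left]

theorem card_filter_powersetCard_mem_disjoint {β : Type*} [Fintype β] [DecidableEq β] (k : ℕ)
    (hk : 1 ≤ k) (a : β) (J : Finset β) (ha : a ∉ J) :
    ((powersetCard k univ).filter fun I => a ∈ I ∧ Disjoint J I).card =
      (Fintype.card β - (J.card + 1)).choose (k - 1) := by
  rw [← card_insert_of_notMem ha, ← card_compl, ← card_powersetCard]
  refine card_bij' (fun I _ => I.erase a) (fun I _ => insert a I) ?_ ?_ ?_ ?_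
  · intro I hI
    simp only [mem_filter, mem_powersetCard, subset_univ, true_and] at hI
    rw [mem_powersetCard, card_erase_of_mem hI.2.1, hI.1]
    refine ⟨fun i hi => ?_, rfl⟩
    rw [mem_erase] at hi
    simp only [mem_compl, mem_insert, not_or]
    exact ⟨hi.1, fun h => disjoint_left.1 hI.2.2 h hi.2⟩
  · intro I hI
    rw [mem_powersetCard, subset_compl_iff_disjoint_left, disjoint_insert_left] at hI
    simp only [mem_filter, mem_powersetCard, subset_univ, true_and, mem_insert_self,
      disjoint_insert_right]
    rw [card_insert_of_notMem hI.1.1]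
    exact ⟨by omega, ha, hI.1.2⟩
  · intro I hI
    exact insert_erase (mem_filter.1 hI).2.1
  · intro I hI
    rw [mem_powersetCard, subset_compl_iff_disjoint_left, disjoint_insert_left] at hI
    exact erase_insert hI.1.1

/-- The set of the first `m` positions in the order given by `σ`. -/
def firstPositions (m : ℕ) (σ : Equiv.Perm (Fin (d + 1))) : Finset (Fin (d + 1)) :=
  (univ.filter fun i : Fin (d + 1) => (i : ℕ) < m).map σ.toEmbedding

theorem card_firstPositions {m : ℕ} (hm : m ≤ d + 1) (σ : Equiv.Perm (Fin (d + 1))) :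
    (firstPositions m σ).card = m := by
  rw [firstPositions, card_map, Fin.card_filter_val_lt, min_eq_right hm]

theorem disjoint_firstPositions {m : ℕ} {σ : Equiv.Perm (Fin (d + 1))}
    {I : Finset (Fin (d + 1))} :
    Disjoint (firstPositions m σ) I ↔ ∀ i : Fin (d + 1), (i : ℕ) < m → σ i ∉ I := by
  rw [firstPositions, disjoint_left]
  simp only [forall_mem_map, mem_filter, mem_univ, true_and, Equiv.coe_toEmbedding]

theorem ncard_typeEntry_staircase {α k : ℕ} (hα : 1 ≤ α) (hαd : α ≤ d + 1) (hk : 1 ≤ k)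
    (σ : Equiv.Perm (Fin (d + 1))) (j : Fin (d + 1)) :
    (typeEntry (genU d k) (staircase α σ) (σ j)).ncard =
      if (j : ℕ) = 0 then Nat.choose (d + 1 - α) k + Nat.choose d (k - 1)
      else if (j : ℕ) < α then Nat.choose (d - (j : ℕ)) (k - 1)
      else 0 := by
  classical
  have key : (typeEntry (genU d k) (staircase α σ) (σ j)).ncard =
      ((powersetCard k univ).filter fun I => IsWinner α σ I j).card := by
    rw [← Set.ncard_image_of_injective _ Subtype.val_injective, ← Set.ncard_coe_finset]
    congr 1
    ext I
    simp [mem_typeEntry_staircase hα, mem_powersetCard, and_comm]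
  rw [key]
  split_ifs with hj hjα
  · obtain rfl : j = 0 := Fin.ext hj
    have h1 := card_filter_powersetCard_disjoint k (firstPositions α σ)
    have h2 := card_filter_powersetCard_mem_disjoint k hk (σ 0) ∅ (notMem_empty _)
    rw [card_firstPositions hαd, Fintype.card_fin] at h1
    simp only [Fintype.card_fin, card_empty, zero_add, Nat.add_sub_cancel] at h2
    rw [← h1, ← h2, ← card_union_of_disjoint, ← filter_or]
    · congr 1
      ext I
      simp [IsWinner, disjoint_firstPositions, or_comm]
    · refine disjoint_filter.2 fun I _ hI h => ?_
      exact disjoint_firstPositions.1 hI 0 (Nat.lt_of_succ_le hα) h.1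
  · have hja : σ j ∉ firstPositions j σ := by simp [firstPositions]
    have h2 := card_filter_powersetCard_mem_disjoint k hk (σ j) (firstPositions j σ) hja
    rw [card_firstPositions j.2.le, Fintype.card_fin, Nat.add_sub_add_right] at h2
    rw [← h2]
    congr 1
    ext I
    have hj0 : j ≠ 0 := fun h => hj (by simp [h])
    simp [IsWinner, disjoint_firstPositions, hj0, hjα]
  · rw [card_eq_zero, filter_eq_empty_iff]
    rintro I - (⟨rfl, -⟩ | h)
    · exact hj rfl
    · exact hjα h.2.1

/-- Every type contains the type of a staircase point. -/
theorem exists_staircase_typeEntry_subset {k : ℕ} (hk2 : 2 ≤ k) (hkd : k ≤ d)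
    (x : Fin (d + 1) → ℝ) :
    ∃ α : ℕ, 1 ≤ α ∧ α ≤ d + 2 - k ∧ ∃ σ : Equiv.Perm (Fin (d + 1)),
      ∀ j, typeEntry (genU d k) (staircase α σ) j ⊆ typeEntry (genU d k) x j := by
  classical
  obtain ⟨σ, hσ⟩ : ∃ σ : Equiv.Perm (Fin (d + 1)), Antitone (x ∘ σ) := by
    refine ⟨Tuple.sort fun i => -x i, fun a b hab => ?_⟩
    simpa using Tuple.monotone_sort (fun i => -x i) hab
  let P : ℕ → Prop := fun m => ∀ i : Fin (d + 1), (i : ℕ) < m → x (σ 0) - 1 < x (σ i)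
  let α := Nat.findGreatest P (d + 2 - k)
  have hP1 : P 1 := by
    intro i hi
    obtain rfl : i = 0 := Fin.ext (by simpa using hi)
    linarith
  have hα1 : 1 ≤ α := Nat.le_findGreatest (by omega) hP1
  have hαk : α ≤ d + 2 - k := Nat.findGreatest_le _
  have hPα : P α := Nat.findGreatest_spec (m := 1) (by omega) hP1
  have hfar : α < d + 2 - k → ∀ i : Fin (d + 1), α ≤ i → x (σ i) ≤ x (σ 0) - 1 := by
    intro hlt i hi
    have hn : ¬ P (α + 1) := Nat.findGreatest_is_greatest (Nat.lt_succ_self _) hlt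
    simp only [P] at hn
    push Not at hn
    obtain ⟨a, ha, hax⟩ := hn
    exact (hσ (show a ≤ i from Fin.le_def.2 (by omega))).trans hax
  refine ⟨α, hα1, hαk, σ, fun j I hI => ?_⟩
  obtain ⟨j, rfl⟩ := σ.surjective j
  rw [mem_typeEntry_staircase hα1] at hI
  rw [mem_typeEntry_iff]
  intro i
  obtain ⟨i, rfl⟩ := σ.surjective i
  have h0 : x (σ i) ≤ x (σ 0) := hσ (Fin.zero_le i)
  simp only [genU]
  rcases hI with ⟨rfl, h | h⟩ | ⟨hj0, hjα, hjI, hmin⟩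
  · split_ifs <;> linarith
  · have hlt : α < d + 2 - k := by
      have hc := card_le_card (subset_compl_iff_disjoint_left.2 (disjoint_firstPositions.2 h))
      rw [I.2, card_compl, card_firstPositions (by omega), Fintype.card_fin] at hc
      omega
    have h0I := h 0 (Nat.lt_of_succ_le hα1)
    have hi := h i
    by_cases hiα : (i : ℕ) < α
    · simp only [h0I, hi hiα, if_false]
      linarith
    · have := hfar hlt i (not_lt.1 hiα)
      split_ifs <;> linarith
  · have hj := hPα j hjα
    simp only [hjI, if_true]
    split_ifs with hiI
    · have : x (σ i) ≤ x (σ j) := hσ (not_lt.1 fun h => hmin i h hiI)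
      linarith
    · linarith

/-- For `2 ≤ k ≤ d`, the coarse types of the inclusion-maximal cells of the
tropical complex of the tropical hypersimplex `Δ_k^d` are, up to the symmetry of
`Sym(d+1)`, exactly the tuples
`(C(d+1-α, k) + C(d, k-1), C(d-1, k-1), …, C(d-α+1, k-1), 0, …, 0)` with `α` nonzero
entries, for `1 ≤ α ≤ d+2-k`. -/
theorem coarseTypes_maxCells_tropicalHypersimplex (d k : ℕ) (hk2 : 2 ≤ k) (hkd : k ≤ d) :
    ∀ t : Fin (d + 1) → ℕ,
      (∃ (X : Set (Fin (d + 1) → ℝ)) (x : Fin (d + 1) → ℝ),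
        IsMaxCell (genU d k) X ∧ IsInteriorPoint (genU d k) X x ∧
        ∀ j, t j = (typeEntry (genU d k) x j).ncard) ↔
      (∃ α : ℕ, 1 ≤ α ∧ α ≤ d + 2 - k ∧
        ∃ σ : Equiv.Perm (Fin (d + 1)),
          ∀ j : Fin (d + 1),
            t (σ j) =
              if (j : ℕ) = 0 then Nat.choose (d + 1 - α) k + Nat.choose d (k - 1)
              else if (j : ℕ) < α then Nat.choose (d - (j : ℕ)) (k - 1)
              else 0) := by
  intro t
  constructor
  · rintro ⟨X, x, hX, hx, ht⟩
    obtain ⟨α, hα1, hαk, σ, hsub⟩ := exists_staircase_typeEntry_subset hk2 hkd x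
    refine ⟨α, hα1, hαk, σ, fun j => ?_⟩
    rw [ht, typeEntry_eq_of_isMaxCell hX hx hsub,
      ncard_typeEntry_staircase hα1 (by omega) (by omega)]
  · rintro ⟨α, hα1, hαk, σ, ht⟩
    refine ⟨closedCell (genU d k) (staircase α σ), staircase α σ,
      isMaxCell_closedCell fun _ _ _ => typeEntry_staircase_unique hα1,
      ⟨fun _ => Set.Subset.rfl, fun _ hy => hy⟩, fun j => ?_⟩
    obtain ⟨j, rfl⟩ := σ.surjective j
    rw [ht, ncard_typeEntry_staircase hα1 (by omega) (by omega)]
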